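/- Let (p_n) ⊂ (0,1] and (q_n) ⊂ (0,1) with 0<q_n<p_n≤1, q_n→1 and p_n→1 as n→∞, and assume that √(p_n^n/q_n)/√([n]_{p_n,q_n}) → 0 and p_n^{n−1}/(p_n^n/q_n + [n]_{p_n,q_n}) → 0 as n→∞. Then for every f ∈ C₂*[0,∞), lim_{n→∞} ‖B*_{n,p_n,q_n}f − f‖₂ = 0, where ‖g‖₂ = sup_{x≥0} |g(x)|/(1+x²). -/

import Mathlib

open Real Set Filter

/-- The (p,q)-integer [n]_{p,q} = (p^n - q^n)/(p - q). -/
noncomputable def pqInt (p q : ℝ) (n : ℕ) : ℝ := (p ^ n - q ^ n) / (p - q)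

/-- The (p,q)-factorial [n]_{p,q}! . -/
noncomputable def pqFact (p q : ℝ) : ℕ → ℝ
  | 0 => 1
  | n + 1 => pqInt p q (n + 1) * pqFact p q n

/-- The (p,q)-binomial coefficient. -/
noncomputable def pqChoose (p q : ℝ) (n k : ℕ) : ℝ :=
  pqFact p q n / (pqFact p q k * pqFact p q (n - k))

/-- (1 ⊕ x)^n_{p,q} = ∏_{j=0}^{n-1} (p^j + q^j x). -/
noncomputable def pqOnePlusPow (p q x : ℝ) (n : ℕ) : ℝ :=
  ∏ j ∈ Finset.range n, (p ^ j + q ^ j * x)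

/-- The (p,q)-Baskakov operator B_{n,p,q}(f;x). -/
noncomputable def baskakov (p q : ℝ) (n : ℕ) (f : ℝ → ℝ) (x : ℝ) : ℝ :=
  ∑' k : ℕ, pqChoose p q (n + k - 1) k * p ^ (k + n * (n - 1) / 2) *
    q ^ (k * (k - 1) / 2) * (x ^ k / pqOnePlusPow p q x (n + k)) *
    f (p ^ (n - 1) * pqInt p q k / (q ^ (k - 1) * pqInt p q n))

/-- The function r_n(x) used in the King-type modification. -/
noncomputable def rn (p q : ℝ) (n : ℕ) (x : ℝ) : ℝ :=
  (-(p ^ (n - 1)) +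
      Real.sqrt (p ^ (2 * n - 2) + 4 * pqInt p q n * (pqInt p q n + p ^ n / q) * x ^ 2)) /
    (2 * (pqInt p q n + p ^ n / q))

/-- The King-type (p,q)-Baskakov operator B*_{n,p,q}(f;x) = B_{n,p,q}(f; r_n(x)). -/
noncomputable def kingBaskakov (p q : ℝ) (n : ℕ) (f : ℝ → ℝ) (x : ℝ) : ℝ :=
  baskakov p q n f (rn p q n x)

lemma HasSum.of_eq {f g : ℕ → ℝ} {a b : ℝ} (h : HasSum f a) (hfg : ∀ k, g k = f k) (hab : b = a) :
    HasSum g b := by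
  rwa [funext hfg, hab]

/-- The `q`-integer `1 + q + ⋯ + q ^ (n - 1)`. -/
noncomputable def qInt (q : ℝ) (n : ℕ) : ℝ := ∑ j ∈ Finset.range n, q ^ j

/-- The `k`-th weight of the `q`-Baskakov operator, defined through the quotient of consecutive
weights. -/
noncomputable def qWeight (q x : ℝ) (n : ℕ) : ℕ → ℝ
  | 0 => (∏ j ∈ Finset.range n, (1 + q ^ j * x))⁻¹
  | k + 1 => qWeight q x n k * (qInt q (n + k) / qInt q (k + 1) * q ^ k * x / (1 + q ^ (n + k) * x))

/-- The `k`-th node of the `q`-Baskakov operator. -/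
noncomputable def qNode (q : ℝ) (n k : ℕ) : ℝ := qInt q k / (q ^ (k - 1) * qInt q n)

section qCalculus

variable {q x : ℝ}

lemma qInt_zero : qInt q 0 = 0 := by simp [qInt]

lemma qInt_succ (n : ℕ) : qInt q (n + 1) = qInt q n + q ^ n := Finset.sum_range_succ _ _

lemma qInt_add (n m : ℕ) : qInt q (n + m) = qInt q n + q ^ n * qInt q m := by
  simp [qInt, Finset.sum_range_add, Finset.mul_sum, pow_add]

lemma qInt_nonneg (hq : 0 < q) (n : ℕ) : 0 ≤ qInt q n :=
  Finset.sum_nonneg fun _ _ => by positivity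

lemma one_le_qInt_succ (hq : 0 < q) (n : ℕ) : 1 ≤ qInt q (n + 1) := by
  have h := qInt_nonneg hq n
  rw [add_comm, qInt_add]
  simp only [qInt, Finset.range_one, Finset.sum_singleton, pow_zero, pow_one]
  have : 0 ≤ q * qInt q n := by positivity
  simpa [qInt] using this

lemma qInt_succ_pos (hq : 0 < q) (n : ℕ) : 0 < qInt q (n + 1) :=
  one_pos.trans_le (one_le_qInt_succ hq n)

lemma qInt_le (hq : 0 < q) (hq1 : q < 1) (n : ℕ) : qInt q n ≤ (1 - q)⁻¹ := by
  rw [← tsum_geometric_of_lt_one hq.le hq1]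
  exact (summable_geometric_of_lt_one hq.le hq1).sum_le_tsum _ fun _ _ => by positivity

lemma qNode_nonneg (hq : 0 < q) (n k : ℕ) : 0 ≤ qNode q n k := by
  have h1 := qInt_nonneg hq n
  have h2 := qInt_nonneg hq k
  unfold qNode
  positivity

lemma qNode_zero (n : ℕ) : qNode q n 0 = 0 := by simp [qNode, qInt_zero]

lemma qWeight_nonneg (hq : 0 < q) (hx : 0 ≤ x) (n k : ℕ) : 0 ≤ qWeight q x n k := by
  induction k with
  | zero =>
    unfold qWeight
    exact inv_nonneg.2 (Finset.prod_nonneg fun _ _ => by positivity)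
  | succ k ih =>
    have h1 := qInt_nonneg hq (n + k)
    have h2 := qInt_nonneg hq (k + 1)
    unfold qWeight
    positivity

lemma qInt_mul_qWeight_succ (hq : 0 < q) (hx : 0 ≤ x) (n k : ℕ) :
    qInt q (k + 1) * qWeight q x n (k + 1) = x * qInt q n * q ^ k * qWeight q x (n + 1) k := by
  induction k with
  | zero =>
    have h : 0 < 1 + q ^ n * x := by positivity
    simp only [qWeight, Finset.prod_range_succ, qInt_succ, qInt_zero, mul_inv]
    generalize (∏ j ∈ Finset.range n, (1 + q ^ j * x))⁻¹ = c
    simp only [add_zero, pow_zero, zero_add]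
    field_simp
  | succ k ih =>
    have h1 := qInt_succ_pos hq k
    have h2 := qInt_succ_pos hq (k + 1)
    have h3 : 0 < 1 + q ^ (n + (k + 1)) * x := by positivity
    rw [qWeight.eq_2 q x n (k + 1), qWeight.eq_2 q x (n + 1) k,
      show n + 1 + k = n + (k + 1) by ring]
    field_simp
    linear_combination (qInt q (n + (k + 1)) * x) * ih

lemma qNode_mul_qWeight_succ (hq : 0 < q) (hx : 0 ≤ x) (n k : ℕ) :
    qNode q (n + 1) (k + 1) * qWeight q x (n + 1) (k + 1) = x * qWeight q x (n + 2) k := by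
  have h := qInt_mul_qWeight_succ hq hx (n + 1) k
  have h1 := qInt_succ_pos hq n
  rw [qNode, add_tsub_cancel_right]
  field_simp
  linear_combination h

lemma qNode_succ (hq : 0 < q) (n k : ℕ) :
    qNode q (n + 1) (k + 1) =
      qInt q (n + 2) / (q * qInt q (n + 1)) * qNode q (n + 2) k + (qInt q (n + 1))⁻¹ := by
  have h1 := qInt_succ_pos hq n
  have h2 : 0 < qInt q (n + 2) := qInt_succ_pos hq (n + 1)
  cases k with
  | zero => simp [qNode, qInt_succ, qInt_zero]
  | succ k =>
    simp only [qNode, add_tsub_cancel_right]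
    rw [qInt_succ (k + 1)]
    field_simp
    ring

lemma sum_qWeight_succ (hq : 0 < q) (hx : 0 ≤ x) (n m : ℕ) :
    ∑ k ∈ Finset.range m, qWeight q x (n + 1) k + (1 + q ^ (n + m) * x) * qWeight q x (n + 1) m =
      ∑ k ∈ Finset.range (m + 1), qWeight q x n k := by
  induction m with
  | zero =>
    have h : 0 < 1 + q ^ n * x := by positivity
    simp [qWeight, Finset.prod_range_succ]
    field_simp
  | succ m ih =>
    rw [Finset.sum_range_succ _ (m + 1), ← ih, Finset.sum_range_succ]
    have h1 := qInt_succ_pos hq m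
    have h2 : 0 < 1 + q ^ (n + (m + 1)) * x := by positivity
    have h3 := qInt_mul_qWeight_succ hq hx n m
    have h4 := qInt_add (q := q) n (m + 1)
    have h5 : qWeight q x n (m + 1) =
        x * qInt q n * q ^ m * qWeight q x (n + 1) m / qInt q (m + 1) := by
      field_simp
      linear_combination h3
    rw [h5, qWeight.eq_2 q x (n + 1) m, show n + 1 + m = n + (m + 1) by ring, h4]
    field_simp
    ring

lemma summable_qWeight (hq : 0 < q) (hq1 : q < 1) (hx : 0 ≤ x) (n : ℕ) :
    Summable (qWeight q x n) := by
  have hlim : Tendsto (fun k : ℕ => (1 - q)⁻¹ * q ^ k * x) atTop (nhds 0) := by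
    simpa using ((tendsto_pow_atTop_nhds_zero_of_lt_one hq.le hq1).const_mul (1 - q)⁻¹).mul_const x
  refine summable_of_ratio_norm_eventually_le (r := 1 / 2) (by norm_num) ?_
  filter_upwards [hlim.eventually_le_const (show (0 : ℝ) < 1 / 2 by norm_num)] with k hk
  rw [Real.norm_of_nonneg (qWeight_nonneg hq hx n k),
    Real.norm_of_nonneg (qWeight_nonneg hq hx n (k + 1)), qWeight, mul_comm]
  refine mul_le_mul_of_nonneg_right (le_trans ?_ hk) (qWeight_nonneg hq hx n k)
  have h1 := qInt_nonneg hq (n + k)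
  have h2 := one_le_qInt_succ hq k
  calc qInt q (n + k) / qInt q (k + 1) * q ^ k * x / (1 + q ^ (n + k) * x)
      ≤ qInt q (n + k) / qInt q (k + 1) * q ^ k * x :=
        div_le_self (by positivity) (by simp; positivity)
    _ ≤ (1 - q)⁻¹ * q ^ k * x := by
        gcongr
        exact (div_le_self h1 h2).trans (qInt_le hq hq1 _)

lemma hasSum_qWeight (hq : 0 < q) (hq1 : q < 1) (hx : 0 ≤ x) (n : ℕ) :
    HasSum (qWeight q x n) 1 := by
  induction n with
  | zero =>
    have h : ∀ k, k ≠ 0 → qWeight q x 0 k = 0 := by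
      intro k hk
      obtain ⟨k, rfl⟩ := Nat.exists_eq_succ_of_ne_zero hk
      have h1 := qInt_mul_qWeight_succ hq hx 0 k
      simpa [qInt_zero, (qInt_succ_pos hq k).ne'] using h1
    simpa [qWeight] using hasSum_single 0 h
  | succ n ih =>
    rw [hasSum_iff_tendsto_nat_of_nonneg (qWeight_nonneg hq hx _)]
    have h1 : Tendsto (fun m => (1 + q ^ (n + m) * x) * qWeight q x (n + 1) m) atTop (nhds 0) := by
      have h2 : Tendsto (fun m : ℕ => 1 + q ^ (n + m) * x) atTop (nhds (1 + 0 * x)) := by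
        have h3 := tendsto_pow_atTop_nhds_zero_of_lt_one hq.le hq1
        simp_rw [add_comm n]
        exact (((tendsto_add_atTop_iff_nat n).2 h3).mul_const x).const_add 1
      simpa using h2.mul (summable_qWeight hq hq1 hx (n + 1)).tendsto_atTop_zero
    have h2 := ((tendsto_add_atTop_iff_nat 1).2 ih.tendsto_sum_nat).sub h1
    rw [sub_zero] at h2
    exact h2.congr fun m => by rw [← sum_qWeight_succ hq hx]; ring

lemma hasSum_qNode_mul_qWeight (hq : 0 < q) (hq1 : q < 1) (hx : 0 ≤ x) (n : ℕ) :
    HasSum (fun k => qNode q (n + 1) k * qWeight q x (n + 1) k) x := by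
  rw [← hasSum_nat_add_iff' 1]
  simp only [qNode_mul_qWeight_succ hq hx]
  simpa [qNode_zero] using (hasSum_qWeight hq hq1 hx (n + 2)).mul_left x

lemma hasSum_qNode_sq_mul_qWeight (hq : 0 < q) (hq1 : q < 1) (hx : 0 ≤ x) (n : ℕ) :
    HasSum (fun k => qNode q (n + 1) k ^ 2 * qWeight q x (n + 1) k)
      ((1 + (q * qInt q (n + 1))⁻¹) * x ^ 2 + (qInt q (n + 1))⁻¹ * x) := by
  have h1 := qInt_succ_pos hq n
  have h := (((hasSum_qNode_mul_qWeight hq hq1 hx (n + 1)).mul_left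
    (qInt q (n + 2) / (q * qInt q (n + 1)))).add
    ((hasSum_qWeight hq hq1 hx (n + 2)).mul_left (qInt q (n + 1))⁻¹)).mul_left x
  rw [← hasSum_nat_add_iff' 1]
  refine h.of_eq (fun k => ?_) ?_
  · rw [sq, mul_assoc, qNode_mul_qWeight_succ hq hx, qNode_succ hq]
    ring
  · have h2 : qInt q (n + 2) = 1 + q * qInt q (n + 1) := by
      rw [show n + 2 = 1 + (n + 1) by ring, qInt_add]
      simp [qInt_succ, qInt_zero]
    simp only [Finset.range_one, Finset.sum_singleton, qNode_zero, h2]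
    field_simp
    ring

end qCalculus

section pqReduction

variable {p q x : ℝ}

lemma pqInt_succ_eq (hq : 0 < q) (hqp : q < p) (n : ℕ) :
    pqInt p q (n + 1) = p ^ n * qInt (q / p) (n + 1) := by
  have hp : 0 < p := hq.trans hqp
  have h : q / p ≠ 1 := ((div_lt_one hp).2 hqp).ne
  have h2 : p - q ≠ 0 := sub_ne_zero.2 hqp.ne'
  have h3 : q - p ≠ 0 := sub_ne_zero.2 hqp.ne
  rw [pqInt, qInt, geom_sum_eq h, div_pow]
  have h4 : q / p - 1 = (q - p) / p := by field_simp
  rw [h4]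
  field_simp
  ring

lemma pqInt_succ_pos (hq : 0 < q) (hqp : q < p) (n : ℕ) : 0 < pqInt p q (n + 1) := by
  have hp : 0 < p := hq.trans hqp
  have := qInt_succ_pos (div_pos hq hp) n
  rw [pqInt_succ_eq hq hqp]
  positivity

lemma pqFact_pos (hq : 0 < q) (hqp : q < p) (n : ℕ) : 0 < pqFact p q n := by
  induction n with
  | zero => exact one_pos
  | succ n ih => exact mul_pos (pqInt_succ_pos hq hqp n) ih

lemma pqOnePlusPow_eq (hp : 0 < p) (n : ℕ) :
    pqOnePlusPow p q x n =
      p ^ (n * (n - 1) / 2) * ∏ j ∈ Finset.range n, (1 + (q / p) ^ j * x) := by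
  induction n with
  | zero => simp [pqOnePlusPow]
  | succ n ih =>
    rw [pqOnePlusPow, Finset.prod_range_succ, ← pqOnePlusPow, ih, Nat.triangle_succ,
      Finset.prod_range_succ, pow_add, div_pow]
    generalize ∏ j ∈ Finset.range n, (1 + (q / p) ^ j * x) = c
    field_simp

lemma pqWeight_eq_qWeight (hq : 0 < q) (hqp : q < p) (hx : 0 ≤ x) (n k : ℕ) :
    pqChoose p q (n + k) k * p ^ (k + (n + 1) * n / 2) * q ^ (k * (k - 1) / 2) *
      (x ^ k / pqOnePlusPow p q x (n + 1 + k)) = qWeight (q / p) x (n + 1) k := by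
  have hp : 0 < p := hq.trans hqp
  induction k with
  | zero =>
    have h : 0 < ∏ j ∈ Finset.range (n + 1), (1 + (q / p) ^ j * x) :=
      Finset.prod_pos fun _ _ => by positivity
    have h1 := pqFact_pos hq hqp n
    rw [qWeight, add_zero, pqOnePlusPow_eq hp]
    generalize ∏ j ∈ Finset.range (n + 1), (1 + (q / p) ^ j * x) = c at *
    simp [pqChoose, pqFact]
    field_simp
  | succ k ih =>
    have h1 := pqFact_pos hq hqp n
    have h2 := pqFact_pos hq hqp k
    have h3 := pqInt_succ_pos hq hqp k
    have h4 : 0 < pqOnePlusPow p q x (n + 1 + k) := Finset.prod_pos fun _ _ => by positivity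
    have h5 := qInt_succ_pos (div_pos hq hp) k
    rw [qWeight, ← ih, Nat.triangle_succ, pqChoose, pqChoose, ← add_assoc n k 1,
      ← add_assoc (n + 1) k 1, pqOnePlusPow, Finset.prod_range_succ, ← pqOnePlusPow, pqFact, pqFact,
      show n + k + 1 - (k + 1) = n by omega, show n + k - k = n by omega,
      pqInt_succ_eq hq hqp (n + k), pqInt_succ_eq hq hqp k, show n + 1 + k = n + k + 1 by ring]
    have h6 : p ^ (n + k + 1) + q ^ (n + k + 1) * x =
        p ^ (n + k + 1) * (1 + (q / p) ^ (n + k + 1) * x) := by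
      rw [div_pow]
      field_simp
    have h7 : 0 < 1 + (q / p) ^ (n + k + 1) * x := by positivity
    rw [show n + 1 + k = n + k + 1 by ring] at h4
    rw [h6, div_pow q p k]
    generalize 1 + (q / p) ^ (n + k + 1) * x = c at *
    generalize pqOnePlusPow p q x (n + k + 1) = d at *
    generalize qInt (q / p) (k + 1) = e at *
    field_simp
    ring

lemma pqNode_eq_qNode (hq : 0 < q) (hqp : q < p) (n k : ℕ) :
    p ^ n * pqInt p q k / (q ^ (k - 1) * pqInt p q (n + 1)) = qNode (q / p) (n + 1) k := by
  have hp : 0 < p := hq.trans hqp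
  have h1 := qInt_succ_pos (div_pos hq hp) n
  cases k with
  | zero => simp [qNode_zero, pqInt]
  | succ k =>
    rw [qNode, pqInt_succ_eq hq hqp, pqInt_succ_eq hq hqp, add_tsub_cancel_right, div_pow]
    generalize qInt (q / p) (n + 1) = e at *
    field_simp

lemma baskakov_eq (hq : 0 < q) (hqp : q < p) (hx : 0 ≤ x) (n : ℕ) (f : ℝ → ℝ) :
    baskakov p q (n + 1) f x =
      ∑' k, qWeight (q / p) x (n + 1) k * f (qNode (q / p) (n + 1) k) := by
  refine tsum_congr fun k => ?_
  have h := pqWeight_eq_qWeight hq hqp hx n k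
  rw [show n + 1 + k - 1 = n + k by omega, add_tsub_cancel_right, h, pqNode_eq_qNode hq hqp]

lemma rn_nonneg (hq : 0 < q) (hqp : q < p) (n : ℕ) : 0 ≤ rn p q (n + 1) x := by
  have hp : 0 < p := hq.trans hqp
  have h1 := pqInt_succ_pos hq hqp n
  refine div_nonneg ?_ (by positivity)
  have : p ^ (n + 1 - 1) ≤ √(p ^ (2 * (n + 1) - 2) +
      4 * pqInt p q (n + 1) * (pqInt p q (n + 1) + p ^ (n + 1) / q) * x ^ 2) := by
    apply Real.le_sqrt_of_sq_le
    rw [← pow_mul, show (n + 1 - 1) * 2 = 2 * (n + 1) - 2 by omega]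
    exact le_add_of_nonneg_right (by positivity)
  linarith

lemma rn_quadratic (hq : 0 < q) (hqp : q < p) (n : ℕ) :
    (1 + (q / p * qInt (q / p) (n + 1))⁻¹) * rn p q (n + 1) x ^ 2 +
      (qInt (q / p) (n + 1))⁻¹ * rn p q (n + 1) x = x ^ 2 := by
  have hp : 0 < p := hq.trans hqp
  have h1 := pqInt_succ_pos hq hqp n
  have h2 := qInt_succ_pos (div_pos hq hp) n
  have hM := pqInt_succ_eq hq hqp n
  set M := pqInt p q (n + 1)
  set N := qInt (q / p) (n + 1)
  have hs := Real.sq_sqrt (show 0 ≤ p ^ (2 * (n + 1) - 2) +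
      4 * M * (M + p ^ (n + 1) / q) * x ^ 2 by positivity)
  set s := √(p ^ (2 * (n + 1) - 2) + 4 * M * (M + p ^ (n + 1) / q) * x ^ 2) with hsdef
  have hD : 0 < M + p ^ (n + 1) / q := by positivity
  have hr : rn p q (n + 1) x = (-p ^ n + s) / (2 * (M + p ^ (n + 1) / q)) := by
    rw [rn, add_tsub_cancel_right]
  have hquad : (M + p ^ (n + 1) / q) * rn p q (n + 1) x ^ 2 + p ^ n * rn p q (n + 1) x =
      M * x ^ 2 := by
    generalize M + p ^ (n + 1) / q = D at *
    rw [show 2 * (n + 1) - 2 = n * 2 by omega, pow_mul] at hs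
    rw [hr]
    field_simp
    linear_combination hs
  rw [hM] at hquad
  have ha : 0 < p ^ n := by positivity
  have hfac : p ^ n * N * ((1 + (q / p * N)⁻¹) * rn p q (n + 1) x ^ 2 +
      N⁻¹ * rn p q (n + 1) x) = p ^ n * N * x ^ 2 := by
    rw [← hquad]
    generalize rn p q (n + 1) x = r
    clear_value N
    field_simp
    ring
  exact mul_left_cancel₀ (by positivity) hfac

lemma rn_defect_le (hq : 0 < q) (hqp : q < p) (hx : 0 ≤ x) (n : ℕ) :
    2 * x ^ 2 - 2 * x * rn p q (n + 1) x ≤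
      4 * (p ^ (n + 1) / q / pqInt p q (n + 1)) * (1 + x ^ 2) := by
  have hp : 0 < p := hq.trans hqp
  have h2 := qInt_succ_pos (div_pos hq hp) n
  have hr := rn_nonneg (x := x) hq hqp n
  have hquad := rn_quadratic (x := x) hq hqp n
  have hc : p ^ (n + 1) / q / pqInt p q (n + 1) = (q / p * qInt (q / p) (n + 1))⁻¹ := by
    rw [pqInt_succ_eq hq hqp]
    generalize qInt (q / p) (n + 1) = N at *
    field_simp
    ring
  have hle : (qInt (q / p) (n + 1))⁻¹ ≤ (q / p * qInt (q / p) (n + 1))⁻¹ := by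
    apply inv_anti₀ (by positivity)
    exact mul_le_of_le_one_left h2.le ((div_le_one hp).2 hqp.le)
  have hd : 0 ≤ (qInt (q / p) (n + 1))⁻¹ := by positivity
  rw [hc]
  generalize (q / p * qInt (q / p) (n + 1))⁻¹ = c at *
  generalize (qInt (q / p) (n + 1))⁻¹ = d at *
  generalize rn p q (n + 1) x = r at *
  have hc0 : 0 ≤ c := hd.trans hle
  have hrx : r ≤ x := by
    apply le_of_sq_le_sq _ hx
    nlinarith [mul_nonneg hc0 (sq_nonneg r), mul_nonneg hd hr]
  have h3 : c * r ^ 2 ≤ c * x ^ 2 := by gcongr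
  have h4 : d * r ≤ c * x := by gcongr
  have h5 : c * x ≤ c * (1 + x ^ 2) := by
    gcongr
    nlinarith [sq_nonneg (x - 1)]
  nlinarith [mul_nonneg hr (sub_nonneg.2 hrx)]

end pqReduction

section Korovkin

variable {f : ℝ → ℝ}

lemma abs_tsum_sub_le {b t : ℕ → ℝ} {x r l ε C : ℝ} (hb : ∀ k, 0 ≤ b k) (ht : ∀ k, 0 ≤ t k)
    (h0 : HasSum b 1) (h1 : HasSum (fun k => t k * b k) r)
    (h2 : HasSum (fun k => t k ^ 2 * b k) (x ^ 2))
    (hf : ∀ s, 0 ≤ s → |f s - f x - l * (s ^ 2 - x ^ 2)| ≤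
      ε * (2 + s ^ 2 + x ^ 2) + C * (s - x) ^ 2) :
    |∑' k, b k * f (t k) - f x| ≤ 2 * ε * (1 + x ^ 2) + C * (2 * x ^ 2 - 2 * x * r) := by
  have hv : HasSum (fun k => b k * (ε * (2 + t k ^ 2 + x ^ 2) + C * (t k - x) ^ 2))
      (2 * ε * (1 + x ^ 2) + C * (2 * x ^ 2 - 2 * x * r)) := by
    refine (((h0.mul_left (ε * (2 + x ^ 2) + C * x ^ 2)).add (h2.mul_left (ε + C))).sub
      (h1.mul_left (2 * C * x))).of_eq (fun k => ?_) ?_ <;> ring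
  have hu : ∀ k, ‖b k * (f (t k) - f x - l * (t k ^ 2 - x ^ 2))‖ ≤
      b k * (ε * (2 + t k ^ 2 + x ^ 2) + C * (t k - x) ^ 2) := fun k => by
    rw [norm_mul, Real.norm_of_nonneg (hb k), Real.norm_eq_abs]
    exact mul_le_mul_of_nonneg_left (hf _ (ht k)) (hb k)
  have hs := (Summable.of_norm_bounded hv.summable hu).hasSum
  have hfs : HasSum (fun k => b k * f (t k))
      (∑' k, b k * (f (t k) - f x - l * (t k ^ 2 - x ^ 2)) + f x) := by
    refine ((hs.add (h0.mul_left (f x - l * x ^ 2))).add (h2.mul_left l)).of_eq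
      (fun k => ?_) ?_ <;> ring
  rw [hfs.tsum_eq, add_sub_cancel_right, ← Real.norm_eq_abs]
  exact tsum_of_norm_bounded hv hu

lemma exists_tendsto_of_abs_tendsto (hfc : ContinuousOn f (Set.Ici 0)) {L : ℝ}
    (h : Tendsto (fun x : ℝ => |f x| / (1 + x ^ 2)) atTop (nhds L)) :
    ∃ l, Tendsto (fun x : ℝ => f x / (1 + x ^ 2)) atTop (nhds l) := by
  have hpos : ∀ x : ℝ, 0 < 1 + x ^ 2 := fun x => by positivity
  rcases eq_or_ne L 0 with rfl | hL
  · refine ⟨0, (tendsto_zero_iff_abs_tendsto_zero _).2 (h.congr fun x => ?_)⟩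
    simp [abs_div, abs_of_pos (hpos x)]
  · obtain ⟨A, hA⟩ := eventually_atTop.1 ((h.eventually_ne hL).and (eventually_ge_atTop 0))
    have hcont : ContinuousOn f (Set.Ici A) :=
      hfc.mono (Set.Ici_subset_Ici.2 (hA A le_rfl).2)
    have hne : ∀ {x}, x ∈ Set.Ici A → |f x| ≠ 0 := fun {x} hx h0 => (hA x hx).1 (by simp [h0])
    rcases isPreconnected_Ici.eq_or_eq_neg_of_sq_eq hcont hcont.abs
      (fun x _ => by simp) hne with h1 | h1
    · refine ⟨L, h.congr' ?_⟩
      filter_upwards [eventually_ge_atTop A] with x hx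
      rw [h1 hx]
      simp
    · refine ⟨-L, h.neg.congr' ?_⟩
      filter_upwards [eventually_ge_atTop A] with x hx
      rw [h1 hx]
      simp [neg_div]

lemma exists_korovkin_bound {g : ℝ → ℝ} (hg : ContinuousOn g (Set.Ici 0))
    (h : Tendsto (fun x : ℝ => g x / (1 + x ^ 2)) atTop (nhds 0)) {ε : ℝ} (hε : 0 < ε) :
    ∃ C, 0 ≤ C ∧ ∀ x s, 0 ≤ x → 0 ≤ s →
      |g s - g x| ≤ ε * (2 + s ^ 2 + x ^ 2) + C * (s - x) ^ 2 := by
  have hpos : ∀ x : ℝ, 0 < 1 + x ^ 2 := fun x => by positivity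
  obtain ⟨A, hA⟩ := eventually_atTop.1
    (((tendsto_zero_iff_abs_tendsto_zero _).1 h).eventually_le_const hε |>.and
      (eventually_ge_atTop 0))
  have hA0 : 0 ≤ A := (hA A le_rfl).2
  have htail : ∀ x, A ≤ x → |g x| ≤ ε * (1 + x ^ 2) := fun x hx => by
    have := (hA x hx).1
    simp only [Function.comp, abs_div, abs_of_pos (hpos x)] at this
    exact (div_le_iff₀ (hpos x)).1 this
  have hgc : ContinuousOn g (Set.Icc 0 (A + 1)) := hg.mono Set.Icc_subset_Ici_self
  obtain ⟨K, hK⟩ := isCompact_Icc.exists_bound_of_continuousOn hgc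
  simp only [Real.norm_eq_abs] at hK
  have hK0 : 0 ≤ K := (abs_nonneg _).trans (hK 0 ⟨le_rfl, by linarith⟩)
  obtain ⟨δ, hδ, hu⟩ := Metric.uniformContinuousOn_iff.1
    (isCompact_Icc.uniformContinuousOn_of_continuous hgc) ε hε
  simp only [Real.dist_eq] at hu
  have hmixed : ∀ x s, 0 ≤ x → x ≤ A → A + 1 ≤ s →
      |g s| + |g x| ≤ ε * (1 + s ^ 2) + K * (s - x) ^ 2 := fun x s hx hxA hs => by
    have h1 := htail s (by linarith)
    have h2 := hK x ⟨hx, by linarith⟩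
    have h3 : 1 ≤ (s - x) ^ 2 := by nlinarith
    nlinarith
  have hC : 0 ≤ 2 * K / δ ^ 2 := by positivity
  refine ⟨K + 2 * K / δ ^ 2, by positivity, fun x s hx hs => ?_⟩
  have hCs : 0 ≤ 2 * K / δ ^ 2 * (s - x) ^ 2 := by positivity
  have hKs : 0 ≤ K * (s - x) ^ 2 := by positivity
  have hεs : 0 ≤ ε * s ^ 2 := by positivity
  have hεx : 0 ≤ ε * x ^ 2 := by positivity
  have htri := abs_sub (g s) (g x)
  by_cases hboth : A ≤ x ∧ A ≤ s
  · have h1 := htail x hboth.1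
    have h2 := htail s hboth.2
    linarith
  by_cases hcpt : x ≤ A + 1 ∧ s ≤ A + 1
  · by_cases hd : |s - x| < δ
    · have := hu s ⟨hs, hcpt.2⟩ x ⟨hx, hcpt.1⟩ hd
      linarith
    · have h1 := hK x ⟨hx, hcpt.1⟩
      have h2 := hK s ⟨hs, hcpt.2⟩
      have h3 : 2 * K ≤ 2 * K / δ ^ 2 * (s - x) ^ 2 := by
        rw [div_mul_eq_mul_div, le_div_iff₀ (by positivity), ← sq_abs (s - x)]
        have := not_lt.1 hd
        gcongr
      linarith
  · rcases le_or_gt x A with hxA | hxA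
    · have := hmixed x s hx hxA (by by_contra! h'; exact hcpt ⟨by linarith, h'.le⟩)
      linarith
    · have hsA : s ≤ A := by by_contra! h'; exact hboth ⟨hxA.le, h'.le⟩
      have := hmixed s x hs hsA (by by_contra! h'; exact hcpt ⟨h'.le, by linarith⟩)
      rw [← neg_sq (x - s), neg_sub] at this
      linarith

end Korovkin

lemma abs_kingBaskakov_sub_le {p q x l ε C : ℝ} {f : ℝ → ℝ} (hq : 0 < q) (hqp : q < p)
    (hx : 0 ≤ x) (hC : 0 ≤ C) (n : ℕ)
    (hf : ∀ s, 0 ≤ s → |f s - f x - l * (s ^ 2 - x ^ 2)| ≤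
      ε * (2 + s ^ 2 + x ^ 2) + C * (s - x) ^ 2) :
    |kingBaskakov p q (n + 1) f x - f x| / (1 + x ^ 2) ≤
      2 * ε + 4 * C * (p ^ (n + 1) / q / pqInt p q (n + 1)) := by
  have hp : 0 < p := hq.trans hqp
  have hQ : 0 < q / p := div_pos hq hp
  have hQ1 : q / p < 1 := (div_lt_one hp).2 hqp
  have hr := rn_nonneg (x := x) hq hqp n
  have h2 := hasSum_qNode_sq_mul_qWeight hQ hQ1 hr n
  rw [rn_quadratic hq hqp] at h2
  have h := abs_tsum_sub_le (qWeight_nonneg hQ hr (n + 1)) (qNode_nonneg hQ (n + 1))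
    (hasSum_qWeight hQ hQ1 hr (n + 1)) (hasSum_qNode_mul_qWeight hQ hQ1 hr n) h2 hf
  rw [kingBaskakov, baskakov_eq hq hqp hr, div_le_iff₀ (by positivity)]
  have h3 := mul_le_mul_of_nonneg_left (rn_defect_le hq hqp hx n) hC
  linarith

theorem weighted_approx (p q : ℕ → ℝ)
    (hq0 : ∀ n, 0 < q n) (hqp : ∀ n, q n < p n) (hp1 : ∀ n, p n ≤ 1)
    (hq1 : Tendsto q atTop (nhds 1)) (hp1' : Tendsto p atTop (nhds 1))
    (h1 : Tendsto (fun n : ℕ =>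
        Real.sqrt ((p n) ^ n / q n) / Real.sqrt (pqInt (p n) (q n) n)) atTop (nhds 0))
    (h2 : Tendsto (fun n : ℕ =>
        (p n) ^ (n - 1) / ((p n) ^ n / q n + pqInt (p n) (q n) n)) atTop (nhds 0))
    (f : ℝ → ℝ) (hfc : ContinuousOn f (Set.Ici 0))
    (hfb : ∃ M : ℝ, ∀ x : ℝ, 0 ≤ x → |f x| ≤ M * (1 + x ^ 2))
    (hflim : ∃ L : ℝ, Tendsto (fun x : ℝ => |f x| / (1 + x ^ 2)) atTop (nhds L)) :
    Tendsto (fun n : ℕ =>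
        ⨆ x : {x : ℝ // 0 ≤ x},
          |kingBaskakov (p n) (q n) n f (x : ℝ) - f (x : ℝ)| / (1 + (x : ℝ) ^ 2))
      atTop (nhds 0) := by
  obtain ⟨L, hL⟩ := hflim
  obtain ⟨l, hl⟩ := exists_tendsto_of_abs_tendsto hfc hL
  have hg : Tendsto (fun x : ℝ => (f x - l * (1 + x ^ 2)) / (1 + x ^ 2)) atTop (nhds 0) := by
    rw [← sub_self l]
    refine (hl.sub_const l).congr fun x => ?_
    have : 0 < 1 + x ^ 2 := by positivity
    field_simp
  have hgc : ContinuousOn (fun x : ℝ => f x - l * (1 + x ^ 2)) (Set.Ici 0) :=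
    hfc.sub (by fun_prop)
  have hpos : ∀ n, 0 < p n := fun n => (hq0 n).trans (hqp n)
  have hc : Tendsto (fun n : ℕ => p n ^ n / q n / pqInt (p n) (q n) n) atTop (nhds 0) := by
    have h := h1.pow 2
    rw [zero_pow two_ne_zero] at h
    refine h.congr' ?_
    filter_upwards [eventually_ge_atTop 1] with n hn
    obtain ⟨m, rfl⟩ := Nat.exists_eq_add_of_le' hn
    have h3 := pqInt_succ_pos (hq0 (m + 1)) (hqp (m + 1)) m
    have h4 := hq0 (m + 1)
    have h5 := hpos (m + 1)
    rw [div_pow, Real.sq_sqrt (by positivity), Real.sq_sqrt h3.le]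
  rw [tendsto_order]
  refine ⟨fun a ha => Eventually.of_forall fun n => ha.trans_le
    (Real.iSup_nonneg fun x => by positivity), fun a ha => ?_⟩
  obtain ⟨C, hC, hbound⟩ := exists_korovkin_bound hgc hg (show 0 < a / 4 by positivity)
  have hlim : Tendsto (fun n : ℕ => 2 * (a / 4) + 4 * C * (p n ^ n / q n / pqInt (p n) (q n) n))
      atTop (nhds (2 * (a / 4) + 4 * C * 0)) := (hc.const_mul _).const_add _
  filter_upwards [hlim.eventually_lt_const (show 2 * (a / 4) + 4 * C * 0 < a by linarith),
    eventually_ge_atTop 1] with n hna hn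
  obtain ⟨m, rfl⟩ := Nat.exists_eq_add_of_le' hn
  have : Nonempty {x : ℝ // 0 ≤ x} := ⟨⟨0, le_rfl⟩⟩
  refine (ciSup_le fun x => ?_).trans_lt hna
  refine abs_kingBaskakov_sub_le (l := l) (hq0 _) (hqp _) x.2 hC m fun s hs => ?_
  convert hbound x s x.2 hs using 2
  ring
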